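/- Assume (A). For each (a,s) ∈ 𝔊° let m_{a,s} = sup_{x∈P_{a,s}} φ_a(x), M_{a,s} = {x ∈ P_{a,s} : φ_a(x) = m_{a,s}}, and let d_{a,s} be the affine dimension of M_{a,s}. Then I(r) ≈ Σ_{(a,s)∈𝔊°} r^{−s−m_{a,s}} (ln(1/r))^{d_{a,s}} ≈ r^{−α₀} (ln(1/r))^{d₀} as r → 0⁺, where α₀ = max{s + m_{a,s} : (a,s) ∈ 𝔊°} and d₀ = max{d_{a,s} : (a,s) ∈ 𝔊° and s + m_{a,s} = α₀}. Moreover, if every s appearing in 𝔊 is a nonnegative integer, then α₀ is a rational number. -/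

import Mathlib

open MeasureTheory
open scoped ENNReal Classical

/-- `I(r) = ∫_{(0,1]^N} x^b / (Σ_{(a,s)∈𝔊} x^a r^s) dx`, with values in `[0,∞]`. -/
noncomputable def Ifun (N : ℕ) (G : Finset ((Fin N → ℕ) × ℝ)) (b : Fin N → ℕ)
    (r : ℝ) : ℝ≥0∞ :=
  ∫⁻ x in Set.univ.pi (fun _ : Fin N => Set.Ioc (0 : ℝ) 1),
    ENNReal.ofReal ((∏ i, x i ^ b i) / ∑ p ∈ G, (∏ i, x i ^ p.1 i) * r ^ p.2)

/-- The polyhedron `P_{a,s} = {y ∈ [0,∞)^N : ⟨a − a′, y⟩ ≤ s′ − s for all (a′,s′) ∈ 𝔊}`. -/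
def Pset (N : ℕ) (G : Finset ((Fin N → ℕ) × ℝ)) (a : Fin N → ℕ) (s : ℝ) :
    Set (Fin N → ℝ) :=
  {y | (∀ i, 0 ≤ y i) ∧ ∀ p ∈ G, ∑ i, ((a i : ℝ) - (p.1 i : ℝ)) * y i ≤ p.2 - s}

/-- The linear function `φ_a(y) = ⟨a − b − 𝟏, y⟩`. -/
def phiFun (N : ℕ) (a b : Fin N → ℕ) (y : Fin N → ℝ) : ℝ :=
  ∑ i, ((a i : ℝ) - (b i : ℝ) - 1) * y i

/-- `𝔊° = {(a,s) ∈ 𝔊 : P_{a,s} has positive N-dimensional Lebesgue measure}`. -/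
noncomputable def Gcirc (N : ℕ) (G : Finset ((Fin N → ℕ) × ℝ)) :
    Finset ((Fin N → ℕ) × ℝ) :=
  G.filter (fun p => 0 < volume (Pset N G p.1 p.2))

/-- `m_{a,s} = sup_{x ∈ P_{a,s}} φ_a(x)`. -/
noncomputable def msup (N : ℕ) (G : Finset ((Fin N → ℕ) × ℝ)) (b : Fin N → ℕ)
    (a : Fin N → ℕ) (s : ℝ) : ℝ :=
  sSup (phiFun N a b '' Pset N G a s)

/-- `d_{a,s}`: the affine dimension of `M_{a,s} = {x ∈ P_{a,s} : φ_a(x) = m_{a,s}}`. -/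
noncomputable def adim (N : ℕ) (G : Finset ((Fin N → ℕ) × ℝ)) (b : Fin N → ℕ)
    (a : Fin N → ℕ) (s : ℝ) : ℕ :=
  Module.finrank ℝ
    (affineSpan ℝ {x ∈ Pset N G a s | phiFun N a b x = msup N G b a s}).direction

section Polyhedron

variable {E ι : Type*} [AddCommGroup E] [Module ℝ E]

/-- The polyhedron cut out by the inequalities `ℓ i y ≤ c i`. -/
def polyhedron (ℓ : ι → E →ₗ[ℝ] ℝ) (c : ι → ℝ) : Set E := {y | ∀ i, ℓ i y ≤ c i}

/-- The set of points of `polyhedron ℓ c` where `φ` takes the value `m`. -/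
def polyFace (ℓ : ι → E →ₗ[ℝ] ℝ) (c : ι → ℝ) (φ : E →ₗ[ℝ] ℝ) (m : ℝ) : Set E :=
  {y ∈ polyhedron ℓ c | φ y = m}

/-- A convex subset of a polyhedron has a point at which only those constraints are active that are
active on the whole subset. -/
theorem exists_mem_forall_active [Finite ι] {ℓ : ι → E →ₗ[ℝ] ℝ} {c : ι → ℝ} {M : Set E}
    (hM : M.Nonempty) (hconv : Convex ℝ M) (hle : M ⊆ polyhedron ℓ c) :
    ∃ x₀ ∈ M, ∀ i, ℓ i x₀ = c i → ∀ x ∈ M, ℓ i x = c i := by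
  obtain ⟨_, ⟨⟨x₀, hx₀⟩, rfl⟩, hmin⟩ :=
    Set.exists_min_image (Set.range fun x : M => {i | ℓ i x = c i})
      Set.ncard (Set.toFinite _) (by obtain ⟨x, hx⟩ := hM; exact ⟨_, ⟨x, hx⟩, rfl⟩)
  refine ⟨x₀, hx₀, fun i hi x hx => ?_⟩
  by_contra hne
  have hz : (1 / 2 : ℝ) • x₀ + (1 / 2 : ℝ) • x ∈ M :=
    hconv hx₀ hx (by norm_num) (by norm_num) (by norm_num)
  refine (hmin _ ⟨⟨_, hz⟩, rfl⟩).not_gt (Set.ncard_lt_ncard ?_ (Set.toFinite _))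
  refine Set.ssubset_iff_subset_ne.2 ⟨fun j hj => ?_, fun heq => ?_⟩
  · have h1 := hle hx₀ j
    have h2 := hle hx j
    simp only [Set.mem_ofPred_eq, map_add, map_smul, smul_eq_mul] at hj ⊢
    linarith
  · have h2 := lt_of_le_of_ne (hle hx i) hne
    have := heq.ge (show i ∈ {j | ℓ j x₀ = c j} from hi)
    simp only [Set.mem_ofPred_eq, map_add, map_smul, smul_eq_mul] at this
    linarith

theorem convex_polyhedron (ℓ : ι → E →ₗ[ℝ] ℝ) (c : ι → ℝ) : Convex ℝ (polyhedron ℓ c) := by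
  intro x hx y hy s t hs ht hst i
  rw [map_add, map_smul, map_smul, smul_eq_mul, smul_eq_mul]
  calc s * ℓ i x + t * ℓ i y ≤ s * c i + t * c i :=
        add_le_add (mul_le_mul_of_nonneg_left (hx i) hs) (mul_le_mul_of_nonneg_left (hy i) ht)
    _ = c i := by rw [← add_mul, hst, one_mul]

theorem convex_polyFace (ℓ : ι → E →ₗ[ℝ] ℝ) (c : ι → ℝ) (φ : E →ₗ[ℝ] ℝ) (m : ℝ) :
    Convex ℝ (polyFace ℓ c φ m) := by
  intro x hx y hy s t hs ht hst
  refine ⟨convex_polyhedron ℓ c hx.1 hy.1 hs ht hst, ?_⟩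
  rw [map_add, map_smul, map_smul, smul_eq_mul, smul_eq_mul, hx.2, hy.2, ← add_mul, hst, one_mul]

/-- The linear map that is the identity on the range of a projection `π` and multiplication by `k`
on its kernel. -/
noncomputable def transverseScaling (π : E →ₗ[ℝ] E) (k : ℝ) : E →ₗ[ℝ] E :=
  π + k • (LinearMap.id - π)

theorem transverseScaling_apply (π : E →ₗ[ℝ] E) (k : ℝ) (z : E) :
    transverseScaling π k z = π z + k • (z - π z) := rfl

end Polyhedron

section Normed

variable {E ι : Type*} [NormedAddCommGroup E] [NormedSpace ℝ E] [FiniteDimensional ℝ E]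

theorem continuous_linear (f : E →ₗ[ℝ] ℝ) : Continuous f := f.continuous_of_finiteDimensional

theorem isClosed_polyhedron (ℓ : ι → E →ₗ[ℝ] ℝ) (c : ι → ℝ) : IsClosed (polyhedron ℓ c) := by
  simp only [polyhedron, Set.ofPred_forall]
  exact isClosed_iInter fun i => isClosed_le (continuous_linear _) continuous_const

/-- If the homogeneous system `g i v ≤ 0` has only the trivial solution, then the solutions of
`g i v ≤ B` are bounded linearly in `B`. -/
theorem exists_norm_le_of_forall_le [Fintype ι] (g : ι → E →ₗ[ℝ] ℝ)
    (h : ∀ v, (∀ i, g i v ≤ 0) → v = 0) :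
    ∃ C : ℝ, 0 ≤ C ∧ ∀ B : ℝ, 0 ≤ B → ∀ v, (∀ i, g i v ≤ B) → ‖v‖ ≤ C * B := by
  set F : E → ℝ := fun v => ∑ i, max (g i v) 0 with hF
  have hFc : Continuous F := continuous_finsetSum _ fun i _ =>
    (continuous_linear _).max continuous_const
  obtain ⟨κ, hκ, hκF⟩ : ∃ κ : ℝ, 0 < κ ∧ ∀ v, ‖v‖ = 1 → κ ≤ F v := by
    by_cases hne : (Metric.sphere (0 : E) 1).Nonempty
    · obtain ⟨v₀, hv₀, hmin⟩ := (isCompact_sphere (0 : E) 1).exists_isMinOn hne hFc.continuousOn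
      refine ⟨F v₀, ?_, fun v hv => hmin (by simpa using hv)⟩
      have h0 : 0 ≤ F v₀ := Finset.sum_nonneg fun i _ => le_max_right _ _
      refine lt_of_le_of_ne h0 fun heq => ?_
      have := (Finset.sum_eq_zero_iff_of_nonneg fun i _ => le_max_right (g i v₀) 0).1 heq.symm
      have : v₀ = 0 := h v₀ fun i => max_eq_right_iff.1 (this i (Finset.mem_univ i))
      simp [this] at hv₀
    · refine ⟨1, one_pos, fun v hv => (hne ⟨v, by simpa using hv⟩).elim⟩
  refine ⟨Fintype.card ι / κ, by positivity, fun B hB v hv => ?_⟩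
  by_cases hv0 : v = 0
  · subst hv0; simp; positivity
  have hn : 0 < ‖v‖ := norm_pos_iff.2 hv0
  have h1 := hκF (‖v‖⁻¹ • v) (by rw [norm_smul, norm_inv, norm_norm, inv_mul_cancel₀ hn.ne'])
  have h2 : F (‖v‖⁻¹ • v) = ‖v‖⁻¹ * F v := by
    simp only [hF, Finset.mul_sum, map_smul, smul_eq_mul]
    refine Finset.sum_congr rfl fun i _ => ?_
    rw [mul_max_of_nonneg _ _ (by positivity), mul_zero]
  have h3 : F v ≤ Fintype.card ι * B := by
    calc F v ≤ ∑ _i : ι, B := Finset.sum_le_sum fun i _ => max_le (hv i) hB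
      _ = _ := by simp
  rw [h2, le_inv_mul_iff₀ hn] at h1
  rw [div_mul_eq_mul_div, le_div_iff₀ hκ]
  linarith

/-- Feasible directions at a point of a polyhedron. -/
theorem exists_pos_add_mem_polyhedron [Finite ι] {ℓ : ι → E →ₗ[ℝ] ℝ} {c : ι → ℝ} {x : E}
    (hx : x ∈ polyhedron ℓ c) :
    ∃ δ : ℝ, 0 < δ ∧ ∀ d, ‖d‖ ≤ δ → (∀ i, ℓ i x = c i → ℓ i d ≤ 0) → x + d ∈ polyhedron ℓ c := by
  have h : ∀ᶠ d in nhds (0 : E), ∀ i, ℓ i x < c i → ℓ i (x + d) < c i := by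
    rw [Filter.eventually_all]
    intro i
    by_cases hi : ℓ i x < c i
    · have : Continuous fun d => ℓ i (x + d) :=
        (continuous_linear (ℓ i)).comp (continuous_const.add continuous_id)
      filter_upwards [this.continuousAt.eventually_lt_const (by simpa using hi)] with d hd _
      exact hd
    · simp [hi]
  obtain ⟨δ, hδ, hball⟩ := Metric.eventually_nhds_iff.1 h
  refine ⟨δ / 2, by positivity, fun d hd hact i => ?_⟩
  rcases (hx i).lt_or_eq with hi | hi
  · exact (hball (by simpa using hd.trans_lt (half_lt_self hδ)) i hi).le
  · rw [map_add, hi]; linarith [hact i hi]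

/-- A linear function that is negative on the recession cone attains its maximum. -/
theorem exists_isMaxOn_polyhedron [Fintype ι] {ℓ : ι → E →ₗ[ℝ] ℝ} {c : ι → ℝ} {φ : E →ₗ[ℝ] ℝ}
    (hne : (polyhedron ℓ c).Nonempty)
    (hrec : ∀ v, (∀ i, ℓ i v ≤ 0) → 0 ≤ φ v → v = 0) :
    ∃ x ∈ polyhedron ℓ c, ∀ y ∈ polyhedron ℓ c, φ y ≤ φ x := by
  obtain ⟨y₀, hy₀⟩ := hne
  obtain ⟨C, hC, hb⟩ := exists_norm_le_of_forall_le
    (fun o : Option ι => o.elim (-φ) ℓ)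
    (fun v hv => hrec v (fun i => hv (some i)) (by simpa using hv none))
  have hcpt : IsCompact (polyhedron ℓ c ∩ {y | φ y₀ ≤ φ y}) := by
    refine Metric.isCompact_of_isClosed_isBounded ((isClosed_polyhedron ℓ c).inter
      (isClosed_le continuous_const (continuous_linear φ))) ?_
    refine isBounded_iff_forall_norm_le.2 ⟨C * (|φ y₀| + ∑ i, |c i|), fun y hy => ?_⟩
    have hs : ∀ i, |c i| ≤ ∑ i, |c i| := fun i =>
      Finset.single_le_sum (f := fun i => |c i|) (fun _ _ => abs_nonneg _) (Finset.mem_univ i)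
    have hs0 : 0 ≤ ∑ i, |c i| := Finset.sum_nonneg fun _ _ => abs_nonneg _
    refine hb _ (by positivity) y fun o => ?_
    cases o with
    | none =>
      have := hy.2
      simp only [Set.mem_ofPred_eq] at this
      simp only [Option.elim_none, LinearMap.neg_apply]
      linarith [neg_abs_le (φ y₀)]
    | some i =>
      have := hy.1 i
      simp only [Option.elim_some]
      linarith [le_abs_self (c i), hs i, abs_nonneg (φ y₀)]
  obtain ⟨x, hx, hmax⟩ := hcpt.exists_isMaxOn ⟨y₀, hy₀, le_refl (φ y₀)⟩ (continuous_linear φ).continuousOn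
  refine ⟨x, hx.1, fun y hy => ?_⟩
  by_cases h : φ y₀ ≤ φ y
  · exact hmax ⟨hy, h⟩
  · exact (not_le.1 h).le.trans hx.2

/-- If the weight `exp ∘ φ` has finite mass on a polyhedron of positive measure, then `φ` is negative
on the nonzero vectors of its recession cone. -/
theorem eq_zero_of_recession [MeasurableSpace E] [BorelSpace E] {μ : Measure E}
    [μ.IsAddHaarMeasure] {ℓ : ι → E →ₗ[ℝ] ℝ} {c : ι → ℝ} {φ : E →ₗ[ℝ] ℝ}
    (hpos : 0 < μ (polyhedron ℓ c))
    (hfin : ∫⁻ y in polyhedron ℓ c, ENNReal.ofReal (Real.exp (φ y)) ∂μ < ⊤)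
    {v : E} (hv : ∀ i, ℓ i v ≤ 0) (hφ : 0 ≤ φ v) : v = 0 := by
  by_contra hv0
  obtain ⟨g, hg⟩ := SeparatingDual.exists_eq_one (R := ℝ) hv0
  have hPm : MeasurableSet (polyhedron ℓ c) := (isClosed_polyhedron ℓ c).measurableSet
  set f : E → ℝ≥0∞ := (polyhedron ℓ c).indicator fun y => ENNReal.ofReal (Real.exp (φ y)) with hf
  have hfm : Measurable f :=
    (ENNReal.measurable_ofReal.comp
      (Real.measurable_exp.comp (continuous_linear φ).measurable)).indicator hPm
  have hfv : ∀ y, f y ≤ f (y + v) := by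
    intro y
    by_cases hy : y ∈ polyhedron ℓ c
    · have hy' : y + v ∈ polyhedron ℓ c := fun i => by
        rw [map_add]; linarith [hy i, hv i]
      simp only [hf, Set.indicator_of_mem hy, Set.indicator_of_mem hy', map_add]
      gcongr
      linarith
    · simp [hf, hy]
  rw [← lintegral_indicator hPm] at hfin
  set S : ℤ → Set E := fun n => g ⁻¹' Set.Ico (n : ℝ) (n + 1) with hS
  have hSm : ∀ n, MeasurableSet (S n) := fun n => g.continuous.measurable measurableSet_Ico
  have hmono : ∀ n, ∫⁻ y in S n, f y ∂μ ≤ ∫⁻ y in S (n + 1), f y ∂μ := by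
    intro n
    rw [← lintegral_indicator (hSm _), ← lintegral_indicator (hSm _),
      ← lintegral_add_right_eq_self ((S (n + 1)).indicator f) v]
    refine lintegral_mono fun y => ?_
    by_cases hy : y ∈ S n
    · have hy' : y + v ∈ S (n + 1) := by
        simp only [hS, Set.mem_preimage, Set.mem_Ico, map_add, hg] at hy ⊢
        push_cast
        constructor <;> linarith [hy.1, hy.2]
      simpa [Set.indicator_of_mem hy, Set.indicator_of_mem hy'] using hfv y
    · simp [hy]
  have hU : ⋃ n, S n = Set.univ := by
    refine Set.eq_univ_of_forall fun y => Set.mem_iUnion.2 ⟨⌊g y⌋, ?_⟩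
    exact ⟨Int.floor_le _, Int.lt_floor_add_one _⟩
  have hdisj : Pairwise (Function.onFun Disjoint S) := by
    intro a b hab
    refine Disjoint.preimage _ ?_
    simpa using Set.pairwise_disjoint_Ico_intCast (α := ℝ) hab
  have htot : ∫⁻ y, f y ∂μ = ∑' n, ∫⁻ y in S n, f y ∂μ := by
    rw [← lintegral_iUnion hSm hdisj, hU, Measure.restrict_univ]
  have hzero : ∀ n, ∫⁻ y in S n, f y ∂μ = 0 := by
    intro n
    by_contra h0
    have hk : ∀ k : ℕ, ∫⁻ y in S n, f y ∂μ ≤ ∫⁻ y in S (n + k), f y ∂μ := by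
      intro k
      induction k with
      | zero => simp
      | succ k ih => push_cast; rw [← add_assoc]; exact ih.trans (hmono _)
    have : (⊤ : ℝ≥0∞) ≤ ∑' n, ∫⁻ y in S n, f y ∂μ := by
      rw [← ENNReal.tsum_const_eq_top_of_ne_zero (α := ℕ) h0]
      refine (ENNReal.tsum_le_tsum hk).trans ?_
      exact ENNReal.tsum_comp_le_tsum_of_injective
        (f := fun k : ℕ => n + (k : ℤ)) (fun a b hab => by simpa using hab) _
    exact absurd (htot ▸ hfin) (not_lt.2 this)
  have hf0 : ∫⁻ y, f y ∂μ = 0 := by rw [htot]; simp [hzero]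
  rw [lintegral_eq_zero_iff hfm] at hf0
  refine hpos.ne' (measure_mono_null (fun y hy => ?_) (ae_iff.1 hf0))
  simp [hf, hy, Real.exp_pos]

end Normed

section Laplace

theorem exp_neg_le_of_le_mul {x t C : ℝ} (hx : 0 ≤ x) (ht : 0 ≤ t) (hC : 0 ≤ C)
    (hxt : x ≤ C * (1 + t)) (k : ℕ) :
    Real.exp (-t) ≤ (1 + C) ^ k * k.factorial * Real.exp 1 * (1 + x) ^ (-(k : ℝ)) := by
  have hn : 0 < 1 + x := by positivity
  rw [Real.rpow_neg hn.le, Real.rpow_natCast, ← div_eq_mul_inv, le_div_iff₀ (by positivity)]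
  have h1 : 1 + x ≤ (1 + C) * (1 + t) := by linarith
  have h2 : (1 + t) ^ k ≤ k.factorial * Real.exp (1 + t) := by
    have := Real.pow_div_factorial_le_exp (x := 1 + t) (by linarith) k
    rwa [div_le_iff₀ (by positivity), mul_comm] at this
  calc Real.exp (-t) * (1 + x) ^ k ≤ Real.exp (-t) * ((1 + C) * (1 + t)) ^ k := by gcongr
    _ = Real.exp (-t) * ((1 + C) ^ k * (1 + t) ^ k) := by rw [mul_pow]
    _ ≤ Real.exp (-t) * ((1 + C) ^ k * (k.factorial * Real.exp (1 + t))) := by gcongr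
    _ = (1 + C) ^ k * k.factorial * Real.exp 1 * (Real.exp (-t) * Real.exp t) := by
      rw [Real.exp_add]; ring
    _ = _ := by rw [← Real.exp_add]; simp

variable {E ι : Type*} [NormedAddCommGroup E] [NormedSpace ℝ E] [FiniteDimensional ℝ E]

theorem det_transverseScaling {W : Submodule ℝ E} {π : E →ₗ[ℝ] E} (hmem : ∀ z, π z ∈ W)
    (hfix : ∀ w ∈ W, π w = w) (k : ℝ) :
    LinearMap.det (transverseScaling π k) =
      k ^ (Module.finrank ℝ E - Module.finrank ℝ W) := by
  have hle : W ≤ W.comap (transverseScaling π k) := fun w hw => by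
    simpa [transverseScaling_apply, hfix w hw] using hw
  have h1 : (transverseScaling π k).restrict hle = LinearMap.id := LinearMap.ext fun w => by
    apply Subtype.ext
    simp [transverseScaling_apply, hfix w w.2]
  have h2 : W.mapQ W (transverseScaling π k) hle = k • LinearMap.id := LinearMap.ext fun x => by
    induction x using Submodule.Quotient.induction_on with
    | _ z =>
      simp only [Submodule.mapQ_apply, LinearMap.smul_apply, LinearMap.id_apply,
        ← Submodule.Quotient.mk_smul, transverseScaling_apply]
      rw [Submodule.Quotient.eq]
      have : π z + k • (z - π z) - k • z = (1 - k) • π z := by module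
      rw [this]
      exact W.smul_mem _ (hmem z)
  rw [LinearMap.det_eq_det_mul_det W _ hle, h1, h2, LinearMap.det_smul]
  simp [Submodule.finrank_quotient]

/-- An affine change of variables in a Lebesgue integral. -/
theorem lintegral_eq_det_mul_lintegral_affine [MeasurableSpace E] [BorelSpace E] (μ : Measure E)
    [μ.IsAddHaarMeasure] {S : E →ₗ[ℝ] E} (hS : LinearMap.det S ≠ 0) (x₀ : E) {F : E → ℝ≥0∞}
    (hF : Measurable F) :
    ∫⁻ y, F y ∂μ = ENNReal.ofReal |LinearMap.det S| * ∫⁻ z, F (x₀ + S z) ∂μ := by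
  have hSm : Measurable S := S.continuous_of_finiteDimensional.measurable
  have h1 : ∫⁻ z, F (x₀ + S z) ∂μ = ∫⁻ y, F (x₀ + y) ∂(Measure.map S μ) :=
    (lintegral_map (hF.comp (measurable_const_add x₀)) hSm).symm
  rw [h1, Measure.map_linearMap_addHaar_eq_smul_addHaar μ hS, lintegral_smul_measure,
    lintegral_add_left_eq_self, smul_eq_mul, ← mul_assoc, ← ENNReal.ofReal_mul (abs_nonneg _),
    ← abs_mul, mul_inv_cancel₀ hS]
  simp

variable [Fintype ι] {ℓ : ι → E →ₗ[ℝ] ℝ} {c : ι → ℝ} {φ : E →ₗ[ℝ] ℝ}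

/-- Coercivity of `-φ` on the polyhedra obtained by blowing up transversally to the optimal face,
uniformly in the blow-up factor. -/
theorem exists_norm_le_of_transverseScaling_mem {x₀ : E} (hx₀ : x₀ ∈ polyhedron ℓ c)
    (hmax : ∀ y ∈ polyhedron ℓ c, φ y ≤ φ x₀)
    (hrec : ∀ v, (∀ i, ℓ i v ≤ 0) → 0 ≤ φ v → v = 0)
    {W : Submodule ℝ E} (hWφ : ∀ w ∈ W, φ w = 0)
    (hWmem : ∀ v, x₀ + v ∈ polyhedron ℓ c → φ v = 0 → v ∈ W)
    (hWact : ∀ w ∈ W, ∀ i, ℓ i x₀ = c i → ℓ i w = 0)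
    {π : E →ₗ[ℝ] E} (hmem : ∀ z, π z ∈ W) (hfix : ∀ w ∈ W, π w = w) :
    ∃ C : ℝ, 0 ≤ C ∧ ∀ L : ℝ, 1 ≤ L → ∀ z, x₀ + transverseScaling π L⁻¹ z ∈ polyhedron ℓ c →
      φ z ≤ 0 ∧ ‖z‖ ≤ C * (1 - φ z) := by
  obtain ⟨C₁, hC₁, hb₁⟩ := exists_norm_le_of_forall_le
    (E := LinearMap.ker π)
    (fun o : Option ι => o.elim (-(φ ∘ₗ (LinearMap.ker π).subtype))
      (fun i => if ℓ i x₀ = c i then ℓ i ∘ₗ (LinearMap.ker π).subtype else 0)) (by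
    rintro ⟨v, hvπ⟩ hv
    have hφ : 0 ≤ φ v := by simpa using hv none
    have hact : ∀ i, ℓ i x₀ = c i → ℓ i v ≤ 0 := fun i hi => by simpa [hi] using hv (some i)
    obtain ⟨δ, hδ, hfeas⟩ := exists_pos_add_mem_polyhedron hx₀
    have hs : 0 < δ / (‖v‖ + 1) := by positivity
    have hin : x₀ + (δ / (‖v‖ + 1)) • v ∈ polyhedron ℓ c := by
      refine hfeas _ ?_ fun i hi => ?_
      · rw [norm_smul, Real.norm_of_nonneg hs.le, div_mul_eq_mul_div, div_le_iff₀ (by positivity)]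
        nlinarith [norm_nonneg v]
      · rw [map_smul, smul_eq_mul]
        exact mul_nonpos_of_nonneg_of_nonpos hs.le (hact i hi)
    have h0 : φ v = 0 := by
      have := hmax _ hin
      rw [map_add, map_smul, smul_eq_mul] at this
      exact le_antisymm (by by_contra h; nlinarith [mul_pos hs (not_le.1 h)]) hφ
    have hvW := hWmem _ hin (by simp [h0])
    have hvW' : v ∈ W := (Submodule.smul_mem_iff _ hs.ne').1 hvW
    have : v = 0 := by rw [← hfix v hvW']; exact hvπ
    exact Subtype.ext this)
  obtain ⟨C₂, hC₂, hb₂⟩ := exists_norm_le_of_forall_le (E := W)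
    (fun i => ℓ i ∘ₗ W.subtype) (fun w hw => Subtype.ext
      (hrec w (fun i => hw i) (hWφ w w.2).ge))
  set A : ℝ := ∑ i, (c i - ℓ i x₀) with hA
  set D : ℝ := ∑ i, ‖(ℓ i).toContinuousLinearMap‖ with hD
  have hAi : ∀ i, c i - ℓ i x₀ ≤ A := fun i => Finset.single_le_sum
    (f := fun i => c i - ℓ i x₀) (fun j _ => sub_nonneg.2 (hx₀ j)) (Finset.mem_univ i)
  have hA0 : 0 ≤ A := Finset.sum_nonneg fun j _ => sub_nonneg.2 (hx₀ j)
  have hD0 : 0 ≤ D := Finset.sum_nonneg fun j _ => norm_nonneg _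
  have hDi : ∀ i u, |ℓ i u| ≤ D * ‖u‖ := fun i u => by
    refine ((ℓ i).toContinuousLinearMap.le_opNorm u).trans ?_
    gcongr
    exact Finset.single_le_sum (f := fun i => ‖(ℓ i).toContinuousLinearMap‖)
      (fun j _ => norm_nonneg _) (Finset.mem_univ i)
  refine ⟨C₂ * A + (C₂ * D + 1) * C₁, by positivity, fun L hL z hz => ?_⟩
  have hL0 : 0 < L⁻¹ := inv_pos.2 (by linarith)
  have hL1 : L⁻¹ ≤ 1 := inv_le_one_of_one_le₀ hL
  set u := z - π z with hu
  have hφu : φ u = φ z := by simp [hu, hWφ _ (hmem z)]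
  have hz' : ∀ i, ℓ i x₀ + (ℓ i (π z) + L⁻¹ * ℓ i u) ≤ c i := fun i => by
    simpa [transverseScaling_apply, hu] using hz i
  have hφz : φ z ≤ 0 := by
    have := hmax _ hz
    simp only [transverseScaling_apply, map_add, map_smul, ← hu, hWφ _ (hmem z), hφu,
      smul_eq_mul] at this
    by_contra h
    nlinarith [mul_pos hL0 (not_le.1 h)]
  have hukπ : u ∈ LinearMap.ker π := by
    simp [hu, hfix _ (hmem z)]
  have hun : ‖u‖ ≤ C₁ * (-φ z) := by
    refine hb₁ _ (by linarith) ⟨u, hukπ⟩ fun o => ?_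
    cases o with
    | none => simp [hφu]
    | some i =>
      by_cases hi : ℓ i x₀ = c i
      · have h1 := hz' i
        rw [hWact _ (hmem z) i hi, hi] at h1
        have : ℓ i u ≤ 0 := by
          by_contra h
          nlinarith [mul_pos hL0 (not_le.1 h)]
        simp only [Option.elim_some, hi, if_true, LinearMap.comp_apply, Submodule.subtype_apply]
        linarith
      · simp [hi, hφz]
  have hwn : ‖π z‖ ≤ C₂ * (A + D * ‖u‖) := by
    refine hb₂ _ (by positivity) ⟨π z, hmem z⟩ fun i => ?_
    have h1 := hz' i
    have h2 : -(D * ‖u‖) ≤ L⁻¹ * ℓ i u := by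
      have : |L⁻¹ * ℓ i u| ≤ D * ‖u‖ := by
        rw [abs_mul, abs_of_pos hL0]
        calc L⁻¹ * |ℓ i u| ≤ 1 * |ℓ i u| := by gcongr
          _ ≤ _ := by rw [one_mul]; exact hDi i u
      linarith [neg_abs_le (L⁻¹ * ℓ i u)]
    have h3 := hAi i
    simp only [LinearMap.comp_apply, Submodule.subtype_apply]
    linarith
  refine ⟨hφz, ?_⟩
  have hzn : ‖z‖ ≤ ‖π z‖ + ‖u‖ := by
    have : z = π z + u := by simp [hu]
    calc ‖z‖ = ‖π z + u‖ := by rw [← this]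
      _ ≤ _ := norm_add_le _ _
  calc ‖z‖ ≤ C₂ * (A + D * ‖u‖) + ‖u‖ := by linarith
    _ = C₂ * A + (C₂ * D + 1) * ‖u‖ := by ring
    _ ≤ C₂ * A + (C₂ * D + 1) * (C₁ * (-φ z)) := by gcongr
    _ ≤ (C₂ * A + (C₂ * D + 1) * C₁) * (1 - φ z) := by
      have h1 : 0 ≤ C₂ * A * (-φ z) := by have : 0 ≤ -φ z := by linarith
                                          positivity
      have h2 : 0 ≤ (C₂ * D + 1) * C₁ := by positivity
      linarith

open scoped Pointwise in
/-- The Laplace asymptotics of `∫ exp (L φ)` over a polyhedron: up to constants, this integral is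
`L ^ (d - n) * exp (L m)`, where `m` is the maximum of `φ` and `d` the dimension of the face on
which it is attained. -/
theorem exists_laplace_polyhedron [MeasurableSpace E] [BorelSpace E] {μ : Measure E}
    [μ.IsAddHaarMeasure] (hpos : 0 < μ (polyhedron ℓ c))
    (hfin : ∫⁻ y in polyhedron ℓ c, ENNReal.ofReal (Real.exp (φ y)) ∂μ < ⊤) :
    ∃ x₀ ∈ polyhedron ℓ c, (∀ y ∈ polyhedron ℓ c, φ y ≤ φ x₀) ∧
      ∃ C : ℝ, 1 ≤ C ∧ ∀ L : ℝ, 1 ≤ L →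
        ENNReal.ofReal (C⁻¹ * (L ^ Module.finrank ℝ
            (affineSpan ℝ (polyFace ℓ c φ (φ x₀))).direction * Real.exp (L * φ x₀))) ≤
          ENNReal.ofReal (L ^ Module.finrank ℝ E) *
            ∫⁻ y in polyhedron ℓ c, ENNReal.ofReal (Real.exp (L * φ y)) ∂μ ∧
        ENNReal.ofReal (L ^ Module.finrank ℝ E) *
            ∫⁻ y in polyhedron ℓ c, ENNReal.ofReal (Real.exp (L * φ y)) ∂μ ≤
          ENNReal.ofReal (C * (L ^ Module.finrank ℝ
            (affineSpan ℝ (polyFace ℓ c φ (φ x₀))).direction * Real.exp (L * φ x₀))) := by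
  have hPm : MeasurableSet (polyhedron ℓ c) := (isClosed_polyhedron ℓ c).measurableSet
  have hrec : ∀ v, (∀ i, ℓ i v ≤ 0) → 0 ≤ φ v → v = 0 := fun v hv hφ =>
    eq_zero_of_recession hpos hfin hv hφ
  obtain ⟨x₁, hx₁, hmax₁⟩ := exists_isMaxOn_polyhedron (nonempty_of_measure_ne_zero hpos.ne') hrec
  obtain ⟨x₀, ⟨hx₀, hφ₀⟩, hact⟩ := exists_mem_forall_active (M := polyFace ℓ c φ (φ x₁))
    ⟨x₁, hx₁, rfl⟩ (convex_polyFace ℓ c φ _) (fun x hx => hx.1)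
  rw [← hφ₀] at hact hmax₁
  refine ⟨x₀, hx₀, hmax₁, ?_⟩
  set M := polyFace ℓ c φ (φ x₀) with hM
  have hx₀M : x₀ ∈ M := ⟨hx₀, rfl⟩
  set W := (affineSpan ℝ M).direction with hW
  have hWker : ∀ f : E →ₗ[ℝ] ℝ, (∀ x ∈ M, f x = f x₀) → ∀ w ∈ W, f w = 0 := by
    intro f hf w hw
    rw [hW, direction_affineSpan, vectorSpan_def] at hw
    have : Submodule.span ℝ (M -ᵥ M) ≤ LinearMap.ker f := by
      rw [Submodule.span_le]
      rintro _ ⟨x, hx, y, hy, rfl⟩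
      simp [hf x hx, hf y hy]
    exact this hw
  have hWφ : ∀ w ∈ W, φ w = 0 := hWker φ fun x hx => hx.2
  have hWact : ∀ w ∈ W, ∀ i, ℓ i x₀ = c i → ℓ i w = 0 := fun w hw i hi =>
    hWker (ℓ i) (fun x hx => (hact i hi x hx).trans hi.symm) w hw
  have hWmem : ∀ v, x₀ + v ∈ polyhedron ℓ c → φ v = 0 → v ∈ W := by
    intro v hv hφv
    have : x₀ + v ∈ M := ⟨hv, by simp [hφv]⟩
    rw [hW, direction_affineSpan]
    simpa using vsub_mem_vectorSpan ℝ this hx₀M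
  obtain ⟨p, hp⟩ := LinearMap.exists_leftInverse_of_injective W.subtype W.ker_subtype
  set π : E →ₗ[ℝ] E := W.subtype ∘ₗ p with hπ
  have hmem : ∀ z, π z ∈ W := fun z => (p z).2
  have hfix : ∀ w ∈ W, π w = w := fun w hw => by
    have := congrArg (fun f => (f ⟨w, hw⟩ : E)) hp
    simpa [hπ] using this
  obtain ⟨K, hK, hbound⟩ :=
    exists_norm_le_of_transverseScaling_mem hx₀ hmax₁ hrec hWφ hWmem hWact hmem hfix
  set n := Module.finrank ℝ E with hn
  set d := Module.finrank ℝ W with hd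
  have hdn : d ≤ n := Submodule.finrank_le W
  set Q : ℝ → Set E := fun L => {z | x₀ + transverseScaling π L⁻¹ z ∈ polyhedron ℓ c} with hQ
  set A : ℝ → ℝ≥0∞ := fun L => ∫⁻ z in Q L, ENNReal.ofReal (Real.exp (φ z)) ∂μ with hA
  have hScont : ∀ k, Continuous (transverseScaling π k) := fun k =>
    (transverseScaling π k).continuous_of_finiteDimensional
  have hQm : ∀ L, MeasurableSet (Q L) := fun L =>
    ((isClosed_polyhedron ℓ c).preimage (continuous_const.add (hScont _))).measurableSet
  have hexpm : ∀ L : ℝ, Measurable fun y => ENNReal.ofReal (Real.exp (L * φ y)) := fun L =>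
    ENNReal.measurable_ofReal.comp
      (Real.measurable_exp.comp ((continuous_linear φ).measurable.const_mul L))
  have hscale : ∀ L : ℝ, 1 ≤ L → ENNReal.ofReal (L ^ n) *
      ∫⁻ y in polyhedron ℓ c, ENNReal.ofReal (Real.exp (L * φ y)) ∂μ =
      ENNReal.ofReal (L ^ d * Real.exp (L * φ x₀)) * A L := by
    intro L hL
    have hL0 : 0 < L := by linarith
    have hdet := det_transverseScaling hmem hfix L⁻¹
    have hdet0 : LinearMap.det (transverseScaling π L⁻¹) ≠ 0 := by rw [hdet]; positivity
    rw [← lintegral_indicator hPm, lintegral_eq_det_mul_lintegral_affine μ hdet0 x₀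
      ((hexpm L).indicator hPm), hdet, ← hn, ← hd, abs_of_pos (by positivity), ← mul_assoc,
      ← ENNReal.ofReal_mul (by positivity)]
    have h1 : L ^ n * L⁻¹ ^ (n - d) = L ^ d := by
      rw [inv_pow, ← div_eq_mul_inv, div_eq_iff (by positivity), ← pow_add]
      congr 1; omega
    rw [h1, ENNReal.ofReal_mul (by positivity), mul_assoc]
    congr 1
    simp only [hA]
    rw [← lintegral_indicator (hQm L), ← lintegral_const_mul']
    · refine lintegral_congr fun z => ?_
      by_cases hz : z ∈ Q L
      · have hz' : x₀ + transverseScaling π L⁻¹ z ∈ polyhedron ℓ c := hz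
        rw [Set.indicator_of_mem hz, Set.indicator_of_mem hz',
          ← ENNReal.ofReal_mul (Real.exp_pos _).le, ← Real.exp_add]
        congr 2
        simp only [transverseScaling_apply, map_add, map_smul, map_sub, hWφ _ (hmem z), smul_eq_mul]
        field_simp
        ring
      · have hz' : x₀ + transverseScaling π L⁻¹ z ∉ polyhedron ℓ c := hz
        rw [Set.indicator_of_notMem hz, Set.indicator_of_notMem hz', mul_zero]
    · exact ENNReal.ofReal_ne_top
  obtain ⟨b, hb⟩ : ∃ b : ℝ, ∀ L, 1 ≤ L → A L ≤ ENNReal.ofReal b := by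
    set κ := (1 + K) ^ (n + 1) * (n + 1).factorial * Real.exp 1
    have hI := finite_integral_one_add_norm (E := E) (μ := μ) (r := ((n + 1 : ℕ) : ℝ))
      (by rw [← hn]; push_cast; linarith)
    have htop : ENNReal.ofReal κ *
        ∫⁻ z, ENNReal.ofReal ((1 + ‖z‖) ^ (-((n + 1 : ℕ) : ℝ))) ∂μ ≠ ⊤ :=
      ENNReal.mul_ne_top ENNReal.ofReal_ne_top hI.ne
    refine ⟨_, fun L hL => le_trans ?_ (ENNReal.ofReal_toReal htop).ge⟩
    rw [← lintegral_const_mul' _ _ ENNReal.ofReal_ne_top]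
    refine le_trans (setLIntegral_mono' (hQm L) fun z hz => ?_) (setLIntegral_le_lintegral _ _)
    obtain ⟨h1, h2⟩ := hbound L hL z hz
    rw [← ENNReal.ofReal_mul (by positivity)]
    refine ENNReal.ofReal_le_ofReal ?_
    simpa using exp_neg_le_of_le_mul (t := -φ z) (norm_nonneg z) (by linarith) hK (by linarith) (n + 1)
  obtain ⟨a, ha0, ha⟩ : ∃ a : ℝ, 0 < a ∧ ∀ L, 1 ≤ L → ENNReal.ofReal a ≤ A L := by
    obtain ⟨δ, hδ, hfeas⟩ := exists_pos_add_mem_polyhedron hx₀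
    set D : Set E := {z | ‖π z‖ + ‖z - π z‖ ≤ δ ∧ ∀ i, ℓ i x₀ = c i → ℓ i z ≤ 0} with hD
    have hDQ : ∀ L, 1 ≤ L → D ⊆ Q L := by
      rintro L hL z ⟨hz1, hz2⟩
      have hL0 : 0 < L⁻¹ := inv_pos.2 (by linarith)
      have hL1 : L⁻¹ ≤ 1 := inv_le_one_of_one_le₀ hL
      refine hfeas _ ?_ fun i hi => ?_
      · rw [transverseScaling_apply]
        refine (norm_add_le _ _).trans (le_trans ?_ hz1)
        rw [norm_smul, Real.norm_of_nonneg hL0.le]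
        gcongr
        exact mul_le_of_le_one_left (norm_nonneg _) hL1
      · simp only [transverseScaling_apply, map_add, map_smul, map_sub,
          hWact _ (hmem z) i hi, smul_eq_mul]
        rw [zero_add, sub_zero]
        exact mul_nonpos_of_nonneg_of_nonpos hL0.le (hz2 i hi)
    have hDpos : μ D ≠ 0 := by
      intro hD0
      refine hpos.ne' ?_
      have hcov : polyhedron ℓ c ⊆ ⋃ k : ℕ, (fun y => -x₀ + y) ⁻¹' (((k : ℝ) + 1) • D) := by
        intro y hy
        set z := -x₀ + y with hz
        obtain ⟨k, hk⟩ := exists_nat_ge ((‖π z‖ + ‖z - π z‖) / δ)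
        refine Set.mem_iUnion.2 ⟨k, ?_⟩
        have hk0 : (0 : ℝ) < (k : ℝ) + 1 := by positivity
        rw [Set.mem_preimage, Set.mem_smul_set_iff_inv_smul_mem₀ hk0.ne']
        refine ⟨?_, fun i hi => ?_⟩
        · rw [map_smul, ← smul_sub, norm_smul, norm_smul, ← mul_add,
            Real.norm_of_nonneg (by positivity), inv_mul_le_iff₀ hk0]
          rw [div_le_iff₀ hδ] at hk
          linarith
        · rw [map_smul, smul_eq_mul]
          refine mul_nonpos_of_nonneg_of_nonpos (by positivity) ?_
          have := hy i
          rw [map_add, map_neg, hi]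
          linarith
      refine measure_mono_null hcov (measure_iUnion_null fun k => ?_)
      rw [measure_preimage_add, Measure.addHaar_smul, hD0, mul_zero]
    have hI0 : ∫⁻ z in D, ENNReal.ofReal (Real.exp (φ z)) ∂μ ≠ 0 := by
      have hm : Measurable fun z => ENNReal.ofReal (Real.exp (φ z)) := by simpa using hexpm 1
      intro h
      rw [lintegral_eq_zero_iff hm] at h
      have h1 : ∀ᵐ z ∂(μ.restrict D), False := by
        filter_upwards [h] with z hz
        simp at hz
        linarith [Real.exp_pos (φ z)]
      rw [ae_iff] at h1
      simp at h1
      exact hDpos h1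
    obtain ⟨a, ha0, ha⟩ := ENNReal.lt_iff_exists_nnreal_btwn.1 (pos_iff_ne_zero.2 hI0)
    refine ⟨a, by exact_mod_cast ha0, fun L hL => ?_⟩
    rw [ENNReal.ofReal_coe_nnreal]
    exact ha.le.trans (lintegral_mono_set (hDQ L hL))
  refine ⟨max 1 (max a⁻¹ b), le_max_left _ _, fun L hL => ?_⟩
  rw [hscale L hL]
  have hL0 : 0 < L := by linarith
  have hX : 0 ≤ L ^ d * Real.exp (L * φ x₀) := by positivity
  constructor
  · rw [mul_comm, ENNReal.ofReal_mul hX]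
    gcongr
    refine le_trans (ENNReal.ofReal_le_ofReal ?_) (ha L hL)
    rw [inv_le_comm₀ (by positivity) ha0]
    exact (le_max_left _ _).trans (le_max_right _ _)
  · rw [mul_comm (max _ _), ENNReal.ofReal_mul hX]
    gcongr
    refine (hb L hL).trans (ENNReal.ofReal_le_ofReal ?_)
    exact (le_max_right _ _).trans (le_max_right _ _)

end Laplace

section IntegerForms

variable {N : ℕ}

/-- The linear form on `ℝ ^ N` with integer coefficients `k`. -/
noncomputable def coordForm (k : Fin N → ℤ) : (Fin N → ℝ) →ₗ[ℝ] ℝ :=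
  ∑ j, (k j : ℝ) • LinearMap.proj j

theorem coordForm_apply (k : Fin N → ℤ) (y : Fin N → ℝ) : coordForm k y = ∑ j, (k j : ℝ) * y j := by
  simp [coordForm]

/-- The maximum of an integral linear form over a polyhedron with integral data is rational. -/
theorem exists_rat_eq_of_isMax {ι : Type*} [Finite ι] {k : ι → Fin N → ℤ} {c : ι → ℝ}
    (hc : ∀ i, ∃ q : ℚ, c i = q) {k' : Fin N → ℤ} {x : Fin N → ℝ}
    (hx : x ∈ polyhedron (fun i => coordForm (k i)) c)
    (hmax : ∀ y ∈ polyhedron (fun i => coordForm (k i)) c, coordForm k' y ≤ coordForm k' x) :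
    ∃ q : ℚ, coordForm k' x = q := by
  obtain ⟨f, hf⟩ := LinearMap.exists_leftInverse_of_injective (Algebra.linearMap ℚ ℝ)
    (LinearMap.ker_eq_bot.2 (algebraMap ℚ ℝ).injective)
  have hfq : ∀ q : ℚ, f q = q := fun q => by
    simpa using congrArg (fun g => g q) hf
  have hform : ∀ k : Fin N → ℤ, coordForm k (fun j => (f (x j) : ℝ)) = f (coordForm k x) := by
    intro k
    rw [coordForm_apply, coordForm_apply, map_sum]
    push_cast
    refine Finset.sum_congr rfl fun j _ => ?_
    have h : (k j : ℝ) * x j = (k j : ℚ) • x j := by rw [Rat.smul_def]; push_cast; rfl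
    rw [h, map_smul, smul_eq_mul]
    push_cast
    rfl
  set d : Fin N → ℝ := (fun j => (f (x j) : ℝ)) - x with hd
  have hact : ∀ i, coordForm (k i) x = c i → coordForm (k i) d = 0 := by
    intro i hi
    obtain ⟨q, hq⟩ := hc i
    rw [hd, map_sub, hform, hi, hq, hfq, sub_self]
  obtain ⟨δ, hδ, hfeas⟩ := exists_pos_add_mem_polyhedron hx
  have hs : 0 < δ / (‖d‖ + 1) := by positivity
  have hle : ∀ t : ℝ, |t| = δ / (‖d‖ + 1) → t * coordForm k' d ≤ 0 := by
    intro t ht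
    have := hmax _ (hfeas (t • d) (by
      rw [norm_smul, Real.norm_eq_abs, ht, div_mul_eq_mul_div, div_le_iff₀ (by positivity)]
      nlinarith [norm_nonneg d]) fun i hi => by rw [map_smul, hact i hi, smul_zero])
    rw [map_add, map_smul, smul_eq_mul] at this
    linarith
  have h1 := hle _ (abs_of_pos hs)
  have h2 := hle (-(δ / (‖d‖ + 1))) (by rw [abs_neg, abs_of_pos hs])
  have h3 : δ / (‖d‖ + 1) * coordForm k' d = 0 := by linarith
  have h4 : coordForm k' d = 0 := (mul_eq_zero.1 h3).resolve_left hs.ne'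
  refine ⟨f (coordForm k' x), ?_⟩
  rw [hd, map_sub, hform] at h4
  linarith

/-- The integral coefficients of the inequalities defining `Pset N G a s`. -/
def pCoeff (G : Finset ((Fin N → ℕ) × ℝ)) (a : Fin N → ℕ) : Fin N ⊕ {p // p ∈ G} → Fin N → ℤ :=
  Sum.elim (fun j => -Pi.single j 1) (fun p i => (a i : ℤ) - p.1.1 i)

/-- The right-hand sides of the inequalities defining `Pset N G a s`. -/
def pBound (G : Finset ((Fin N → ℕ) × ℝ)) (s : ℝ) : Fin N ⊕ {p // p ∈ G} → ℝ :=
  Sum.elim (fun _ => 0) (fun p => p.1.2 - s)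

theorem Pset_eq_polyhedron (G : Finset ((Fin N → ℕ) × ℝ)) (a : Fin N → ℕ) (s : ℝ) :
    Pset N G a s = polyhedron (fun i => coordForm (pCoeff G a i)) (pBound G s) := by
  ext y
  simp [Pset, polyhedron, coordForm_apply, pCoeff, pBound, Pi.single_apply]

theorem phiFun_eq_coordForm (a b : Fin N → ℕ) :
    phiFun N a b = coordForm (fun i => (a i : ℤ) - b i - 1) := by
  ext y
  simp [phiFun, coordForm_apply]

end IntegerForms

section ChangeOfVariables

variable {N : ℕ}

theorem measurableSet_Pset (G : Finset ((Fin N → ℕ) × ℝ)) (a : Fin N → ℕ) (s : ℝ) :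
    MeasurableSet (Pset N G a s) := by
  rw [Pset_eq_polyhedron]
  exact (isClosed_polyhedron _ _).measurableSet

/-- The integrand of `Ifun` after the substitution `x = exp (-L y)`. -/
noncomputable def expIntegrand (G : Finset ((Fin N → ℕ) × ℝ)) (b : Fin N → ℕ) (L : ℝ)
    (y : Fin N → ℝ) : ℝ :=
  L ^ N * Real.exp (-L * ∑ i, ((b i : ℝ) + 1) * y i) /
    ∑ p ∈ G, Real.exp (-L * (∑ i, (p.1 i : ℝ) * y i + p.2))

theorem prod_exp_pow (L : ℝ) (y : Fin N → ℝ) (a : Fin N → ℕ) :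
    ∏ i, Real.exp (-L * y i) ^ a i = Real.exp (-L * ∑ i, (a i : ℝ) * y i) := by
  rw [Finset.mul_sum, Real.exp_sum]
  refine Finset.prod_congr rfl fun i _ => ?_
  rw [← Real.exp_nat_mul]
  ring_nf

theorem Ifun_exp_neg (G : Finset ((Fin N → ℕ) × ℝ)) (b : Fin N → ℕ) {L : ℝ} (hL : 0 < L) :
    Ifun N G b (Real.exp (-L)) =
      ∫⁻ y in Set.univ.pi fun _ : Fin N => Set.Ici (0 : ℝ),
        ENNReal.ofReal (expIntegrand G b L y) := by
  set f : (Fin N → ℝ) → Fin N → ℝ := fun y i => Real.exp (-L * y i) with hf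
  have himage : f '' (Set.univ.pi fun _ : Fin N => Set.Ici (0 : ℝ)) =
      Set.univ.pi fun _ : Fin N => Set.Ioc (0 : ℝ) 1 := by
    ext x
    constructor
    · rintro ⟨y, hy, rfl⟩ i _
      have := hy i trivial
      refine ⟨Real.exp_pos _, Real.exp_le_one_iff.2 ?_⟩
      rw [Set.mem_Ici] at this
      nlinarith
    · intro hx
      refine ⟨fun i => -(L⁻¹ * Real.log (x i)), fun i _ => ?_, ?_⟩
      · have := hx i trivial
        exact neg_nonneg.2 (mul_nonpos_of_nonneg_of_nonpos (by positivity)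
          (Real.log_nonpos this.1.le this.2))
      · ext i
        have : -L * -(L⁻¹ * Real.log (x i)) = Real.log (x i) := by field_simp
        simp only [hf, this]
        exact Real.exp_log (hx i trivial).1
  have hinj : Function.Injective f := by
    intro y z hyz
    ext i
    have := Real.exp_injective (congrFun hyz i)
    simpa [hL.ne'] using this
  set f' : (Fin N → ℝ) → (Fin N → ℝ) →L[ℝ] (Fin N → ℝ) := fun y =>
    ContinuousLinearMap.pi fun i => ((Real.exp (-L * y i) * -L) •
      ContinuousLinearMap.id ℝ ℝ).comp (ContinuousLinearMap.proj i) with hf'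
  have hderiv : ∀ y, HasFDerivAt f (f' y) y := by
    intro y
    refine hasFDerivAt_pi.2 fun i => ?_
    have h1 : HasDerivAt (fun t : ℝ => Real.exp (-L * t)) (Real.exp (-L * y i) * -L) (y i) := by
      simpa using ((hasDerivAt_id (y i)).const_mul (-L)).exp
    have hproj : HasFDerivAt (fun z : Fin N → ℝ => z i)
        (ContinuousLinearMap.proj i : (Fin N → ℝ) →L[ℝ] ℝ) y := hasFDerivAt_apply i y
    have h2 := HasDerivAt.comp_hasFDerivAt (f := fun z : Fin N → ℝ => z i) y h1 hproj
    refine h2.congr_fderiv ?_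
    ext v
    simp
  have hdet : ∀ y, |(f' y).det| = L ^ N * Real.exp (-L * ∑ i, y i) := by
    intro y
    rw [hf', ContinuousLinearMap.det_pi, Finset.abs_prod, Finset.mul_sum, Real.exp_sum]
    have : ∀ i, |((Real.exp (-L * y i) * -L) • ContinuousLinearMap.id ℝ ℝ).det| =
        L * Real.exp (-L * y i) := fun i => by
      rw [ContinuousLinearMap.det]
      simp [abs_of_pos hL, mul_comm]
    simp only [this, Finset.prod_mul_distrib]
    simp
  rw [Ifun, ← himage, lintegral_image_eq_lintegral_abs_det_fderiv_mul volume
    (MeasurableSet.univ_pi fun _ => measurableSet_Ici)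
    (fun y _ => (hderiv y).hasFDerivWithinAt) hinj.injOn]
  refine lintegral_congr fun y => ?_
  rw [← ENNReal.ofReal_mul (abs_nonneg _), hdet]
  congr 1
  simp only [hf, prod_exp_pow, expIntegrand]
  rw [← mul_div_assoc, mul_assoc, ← Real.exp_add]
  congr 1
  · congr 2
    rw [← mul_add, ← Finset.sum_add_distrib]
    congr 1
    exact Finset.sum_congr rfl fun i _ => by ring
  · refine Finset.sum_congr rfl fun p _ => ?_
    rw [← Real.exp_mul, ← Real.exp_add]
    congr 1
    ring

/-- The contribution of the pair `p` to the integral `Ifun` at `r = exp (-L)`. -/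
noncomputable def Jfun (G : Finset ((Fin N → ℕ) × ℝ)) (b : Fin N → ℕ) (L : ℝ)
    (p : (Fin N → ℕ) × ℝ) : ℝ≥0∞ :=
  ENNReal.ofReal (L ^ N * Real.exp (L * p.2)) *
    ∫⁻ y in Pset N G p.1 p.2, ENNReal.ofReal (Real.exp (L * phiFun N p.1 b y))

theorem expIntegrand_bounds {G : Finset ((Fin N → ℕ) × ℝ)} {b : Fin N → ℕ} {L : ℝ} (hL : 0 < L)
    {p : (Fin N → ℕ) × ℝ} (hp : p ∈ G) {y : Fin N → ℝ} (hy : y ∈ Pset N G p.1 p.2) :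
    (G.card : ℝ)⁻¹ * (L ^ N * Real.exp (L * p.2) * Real.exp (L * phiFun N p.1 b y)) ≤
        expIntegrand G b L y ∧
      expIntegrand G b L y ≤ L ^ N * Real.exp (L * p.2) * Real.exp (L * phiFun N p.1 b y) := by
  set T : (Fin N → ℕ) × ℝ → ℝ := fun q => Real.exp (-L * (∑ i, (q.1 i : ℝ) * y i + q.2)) with hT
  have hTpos : ∀ q, 0 < T q := fun q => Real.exp_pos _
  have hle : ∀ q ∈ G, T q ≤ T p := by
    intro q hq
    have h := hy.2 q hq
    simp only [sub_mul, Finset.sum_sub_distrib] at h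
    refine Real.exp_le_exp.2 ?_
    nlinarith
  have h1 : T p ≤ ∑ q ∈ G, T q := Finset.single_le_sum (fun q _ => (hTpos q).le) hp
  have h2 : ∑ q ∈ G, T q ≤ G.card * T p := by
    simpa using Finset.sum_le_card_nsmul G T _ hle
  have hG : (0 : ℝ) < G.card := by exact_mod_cast Finset.card_pos.2 ⟨p, hp⟩
  have hE : L ^ N * Real.exp (L * p.2) * Real.exp (L * phiFun N p.1 b y) =
      L ^ N * Real.exp (-L * ∑ i, ((b i : ℝ) + 1) * y i) / T p := by
    rw [hT, mul_assoc, ← Real.exp_add, mul_div_assoc, ← Real.exp_sub]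
    congr 2
    have : phiFun N p.1 b y = ∑ i, (p.1 i : ℝ) * y i - ∑ i, ((b i : ℝ) + 1) * y i := by
      rw [phiFun, ← Finset.sum_sub_distrib]
      exact Finset.sum_congr rfl fun i _ => by ring
    rw [this]
    ring
  have hX : 0 ≤ L ^ N * Real.exp (-L * ∑ i, ((b i : ℝ) + 1) * y i) := by positivity
  rw [hE, expIntegrand]
  constructor
  · rw [inv_mul_eq_div, div_div, mul_comm (T p)]
    exact div_le_div_of_nonneg_left hX ((hTpos p).trans_le h1) h2
  · exact div_le_div_of_nonneg_left hX (hTpos p) h1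

theorem orthant_subset_iUnion_Pset {G : Finset ((Fin N → ℕ) × ℝ)} (hG : G.Nonempty) :
    (Set.univ.pi fun _ : Fin N => Set.Ici (0 : ℝ)) ⊆ ⋃ p ∈ G, Pset N G p.1 p.2 := by
  intro y hy
  obtain ⟨p, hp, hmin⟩ := G.exists_min_image (fun p => ∑ i, (p.1 i : ℝ) * y i + p.2) hG
  refine Set.mem_iUnion₂.2 ⟨p, hp, fun i => hy i trivial, fun q hq => ?_⟩
  have := hmin q hq
  simp only [sub_mul, Finset.sum_sub_distrib]
  linarith

theorem Gcirc_nonempty {G : Finset ((Fin N → ℕ) × ℝ)} (hG : G.Nonempty) : (Gcirc N G).Nonempty := by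
  by_contra h
  have h0 : ∀ p ∈ G, volume (Pset N G p.1 p.2) = 0 := fun p hp => by
    by_contra hne
    exact h ⟨p, Finset.mem_filter.2 ⟨hp, pos_iff_ne_zero.2 hne⟩⟩
  have h1 : volume (Set.univ.pi fun _ : Fin N => Set.Icc (0 : ℝ) 1) = 0 := by
    refine measure_mono_null ((Set.pi_mono fun _ _ => Set.Icc_subset_Ici_self).trans
      (orthant_subset_iUnion_Pset hG)) ?_
    exact (measure_biUnion_null_iff G.countable_toSet).2 h0
  rw [volume_pi_pi] at h1
  simp at h1

theorem card_inv_mul_Jfun_le {G : Finset ((Fin N → ℕ) × ℝ)} {b : Fin N → ℕ} {L : ℝ} (hL : 0 < L)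
    {p : (Fin N → ℕ) × ℝ} (hp : p ∈ G) :
    ENNReal.ofReal (G.card : ℝ)⁻¹ * Jfun G b L p ≤ Ifun N G b (Real.exp (-L)) := by
  rw [Ifun_exp_neg G b hL, Jfun, ← lintegral_const_mul' _ _ ENNReal.ofReal_ne_top,
    ← lintegral_const_mul' _ _ ENNReal.ofReal_ne_top]
  refine le_trans (setLIntegral_mono' (measurableSet_Pset G p.1 p.2) fun y hy => ?_)
    (lintegral_mono_set fun y hy i _ => hy.1 i)
  rw [← ENNReal.ofReal_mul (by positivity), ← ENNReal.ofReal_mul (by positivity)]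
  exact ENNReal.ofReal_le_ofReal (expIntegrand_bounds hL hp hy).1

theorem Ifun_le_sum_Jfun {G : Finset ((Fin N → ℕ) × ℝ)} (hG : G.Nonempty) {b : Fin N → ℕ} {L : ℝ}
    (hL : 0 < L) : Ifun N G b (Real.exp (-L)) ≤ ∑ p ∈ Gcirc N G, Jfun G b L p := by
  have hcirc : ∑ p ∈ Gcirc N G, Jfun G b L p = ∑ p ∈ G, Jfun G b L p := by
    refine Finset.sum_subset (Finset.filter_subset _ _) fun p hp hnp => ?_
    have : volume (Pset N G p.1 p.2) = 0 := by
      by_contra hne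
      exact hnp (Finset.mem_filter.2 ⟨hp, pos_iff_ne_zero.2 hne⟩)
    rw [Jfun, setLIntegral_measure_zero _ _ this, mul_zero]
  rw [hcirc, Ifun_exp_neg G b hL]
  calc _ ≤ ∫⁻ y in ⋃ p ∈ G, Pset N G p.1 p.2, ENNReal.ofReal (expIntegrand G b L y) :=
        lintegral_mono_set (orthant_subset_iUnion_Pset hG)
    _ ≤ ∑ p ∈ G, ∫⁻ y in Pset N G p.1 p.2, ENNReal.ofReal (expIntegrand G b L y) := by
        rw [← lintegral_finsetSum_measure]
        refine lintegral_mono' (Measure.le_iff.2 fun A hA => ?_) le_rfl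
        rw [Measure.restrict_apply hA, Measure.finsetSum_apply, Set.inter_iUnion₂]
        refine (measure_biUnion_finset_le G _).trans (le_of_eq ?_)
        exact Finset.sum_congr rfl fun p _ => (Measure.restrict_apply hA).symm
    _ ≤ ∑ p ∈ G, Jfun G b L p := by
        refine Finset.sum_le_sum fun p hp => ?_
        rw [Jfun, ← lintegral_const_mul' _ _ ENNReal.ofReal_ne_top]
        refine setLIntegral_mono' (measurableSet_Pset G p.1 p.2) fun y hy => ?_
        rw [← ENNReal.ofReal_mul (by positivity)]
        exact ENNReal.ofReal_le_ofReal (expIntegrand_bounds hL hp hy).2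

end ChangeOfVariables

section Assembly

variable {N : ℕ}

theorem lintegral_exp_phiFun_lt_top {G : Finset ((Fin N → ℕ) × ℝ)} {b : Fin N → ℕ}
    (hA : Ifun N G b (Real.exp (-1)) < ⊤) {p : (Fin N → ℕ) × ℝ} (hp : p ∈ G) :
    ∫⁻ y in Pset N G p.1 p.2, ENNReal.ofReal (Real.exp (phiFun N p.1 b y)) < ⊤ := by
  have hG : (0 : ℝ) < G.card := by exact_mod_cast Finset.card_pos.2 ⟨p, hp⟩
  have h := (card_inv_mul_Jfun_le (b := b) one_pos hp).trans_lt hA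
  rw [Jfun, ← mul_assoc] at h
  simp only [one_mul] at h
  refine ENNReal.lt_top_of_mul_ne_top_right h.ne ?_
  rw [← ENNReal.ofReal_mul (by positivity)]
  exact (ENNReal.ofReal_pos.2 (by positivity)).ne'

/-- The optimum `msup` is attained, and `Jfun` has the predicted order of growth. -/
theorem exists_Jfun_bounds {G : Finset ((Fin N → ℕ) × ℝ)} {b : Fin N → ℕ}
    (hA : Ifun N G b (Real.exp (-1)) < ⊤) {p : (Fin N → ℕ) × ℝ} (hp : p ∈ Gcirc N G) :
    (∃ x ∈ Pset N G p.1 p.2, (∀ y ∈ Pset N G p.1 p.2, phiFun N p.1 b y ≤ phiFun N p.1 b x) ∧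
      msup N G b p.1 p.2 = phiFun N p.1 b x) ∧
    ∃ C : ℝ, 1 ≤ C ∧ ∀ L : ℝ, 1 ≤ L →
      ENNReal.ofReal (C⁻¹ * (L ^ adim N G b p.1 p.2 *
          Real.exp (L * (p.2 + msup N G b p.1 p.2)))) ≤ Jfun G b L p ∧
      Jfun G b L p ≤ ENNReal.ofReal (C * (L ^ adim N G b p.1 p.2 *
          Real.exp (L * (p.2 + msup N G b p.1 p.2)))) := by
  obtain ⟨hpG, hpos⟩ := Finset.mem_filter.1 hp
  have hfin := lintegral_exp_phiFun_lt_top hA hpG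
  have hP := Pset_eq_polyhedron G p.1 p.2
  have hφ := phiFun_eq_coordForm p.1 b
  rw [hP] at hpos
  rw [hP, hφ] at hfin
  obtain ⟨x, hx, hmax, C, hC, hb⟩ := exists_laplace_polyhedron hpos hfin
  have hm : msup N G b p.1 p.2 = phiFun N p.1 b x := by
    rw [msup, hP, hφ]
    exact IsGreatest.csSup_eq ⟨⟨x, hx, rfl⟩, by rintro _ ⟨y, hy, rfl⟩; exact hmax y hy⟩
  have hd : adim N G b p.1 p.2 = Module.finrank ℝ (affineSpan ℝ (polyFace
      (fun i => coordForm (pCoeff G p.1 i)) (pBound G p.2)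
      (coordForm (fun i => (p.1 i : ℤ) - b i - 1))
      (coordForm (fun i => (p.1 i : ℤ) - b i - 1) x))).direction := by
    rw [adim, hm, hP, hφ]
    rfl
  refine ⟨⟨x, by rwa [hP], by rwa [hP, hφ], hm⟩, C, hC, fun L hL => ?_⟩
  have hL0 : 0 < L := by linarith
  have hX : ∀ K : ℝ, K * (L ^ adim N G b p.1 p.2 * Real.exp (L * (p.2 + msup N G b p.1 p.2))) =
      Real.exp (L * p.2) * (K * (L ^ adim N G b p.1 p.2 * Real.exp (L * phiFun N p.1 b x))) := by
    intro K
    rw [hm, mul_add, Real.exp_add]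
    ring
  have hJ : Jfun G b L p = ENNReal.ofReal (Real.exp (L * p.2)) * (ENNReal.ofReal (L ^ N) *
      ∫⁻ y in Pset N G p.1 p.2, ENNReal.ofReal (Real.exp (L * phiFun N p.1 b y))) := by
    rw [Jfun, mul_comm (L ^ N), ENNReal.ofReal_mul (Real.exp_pos _).le, mul_assoc]
  obtain ⟨h1, h2⟩ := hb L hL
  rw [Module.finrank_fin_fun, ← hd] at h1 h2
  rw [hX, hX, hJ, ENNReal.ofReal_mul (Real.exp_pos _).le, ENNReal.ofReal_mul (Real.exp_pos _).le,
    hP, hφ]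
  exact ⟨by gcongr, by gcongr⟩

theorem exists_pow_le_mul_exp (d : ℕ) {ε : ℝ} (hε : 0 < ε) :
    ∃ C : ℝ, 0 ≤ C ∧ ∀ L : ℝ, 0 ≤ L → L ^ d ≤ C * Real.exp (L * ε) := by
  refine ⟨d.factorial / ε ^ d, by positivity, fun L hL => ?_⟩
  have h := Real.pow_div_factorial_le_exp (x := L * ε) (by positivity) d
  rw [div_le_iff₀ (by positivity), mul_pow] at h
  rw [div_mul_eq_mul_div, le_div_iff₀ (by positivity)]
  linarith

/-- A finite sum of terms `L ^ d * exp (L * α)` is comparable to its lexicographically leading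
term. -/
theorem exists_sum_le_leading {κ : Type*} (s : Finset κ) (α : κ → ℝ) (d : κ → ℕ) {α₀ : ℝ} {d₀ : ℕ}
    (hα : ∀ p ∈ s, α p ≤ α₀) (hd : ∀ p ∈ s, α p = α₀ → d p ≤ d₀) :
    ∃ C : ℝ, 0 ≤ C ∧ ∀ L : ℝ, 1 ≤ L →
      ∑ p ∈ s, L ^ d p * Real.exp (L * α p) ≤ C * (L ^ d₀ * Real.exp (L * α₀)) := by
  have h : ∀ p, ∃ C : ℝ, 0 ≤ C ∧ (p ∈ s → ∀ L : ℝ, 1 ≤ L →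
      L ^ d p * Real.exp (L * α p) ≤ C * (L ^ d₀ * Real.exp (L * α₀))) := by
    intro p
    by_cases hp : p ∈ s
    · rcases (hα p hp).lt_or_eq with hlt | heq
      · obtain ⟨C, hC, hb⟩ := exists_pow_le_mul_exp (d p) (sub_pos.2 hlt)
        refine ⟨C, hC, fun _ L hL => ?_⟩
        calc L ^ d p * Real.exp (L * α p)
            ≤ C * Real.exp (L * (α₀ - α p)) * Real.exp (L * α p) := by
              gcongr
              exact hb L (by linarith)
          _ = C * (1 * Real.exp (L * α₀)) := by
              rw [mul_assoc, ← Real.exp_add, one_mul]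
              ring_nf
          _ ≤ _ := by
              gcongr
              exact one_le_pow₀ hL
      · refine ⟨1, zero_le_one, fun _ L hL => ?_⟩
        rw [one_mul, heq]
        gcongr
        exact hd p hp heq
    · exact ⟨0, le_rfl, fun h => (hp h).elim⟩
  choose C hC hb using h
  refine ⟨∑ p ∈ s, C p, Finset.sum_nonneg fun p _ => hC p, fun L hL => ?_⟩
  rw [Finset.sum_mul]
  exact Finset.sum_le_sum fun p hp => hb p hp L hL

/-- Two-sided bound for `Ifun` at `r = exp (-L)`. -/
theorem exists_Ifun_bounds {G : Finset ((Fin N → ℕ) × ℝ)} (hG : G.Nonempty) {b : Fin N → ℕ}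
    (hA : Ifun N G b (Real.exp (-1)) < ⊤) :
    ∃ C : ℝ, 1 ≤ C ∧ ∀ L : ℝ, 1 ≤ L →
      ENNReal.ofReal (C⁻¹ * ∑ p ∈ Gcirc N G, L ^ adim N G b p.1 p.2 *
          Real.exp (L * (p.2 + msup N G b p.1 p.2))) ≤ Ifun N G b (Real.exp (-L)) ∧
      Ifun N G b (Real.exp (-L)) ≤ ENNReal.ofReal (C * ∑ p ∈ Gcirc N G,
          L ^ adim N G b p.1 p.2 * Real.exp (L * (p.2 + msup N G b p.1 p.2))) := by
  have h : ∀ p, ∃ C : ℝ, 1 ≤ C ∧ (p ∈ Gcirc N G → ∀ L : ℝ, 1 ≤ L →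
      ENNReal.ofReal (C⁻¹ * (L ^ adim N G b p.1 p.2 *
          Real.exp (L * (p.2 + msup N G b p.1 p.2)))) ≤ Jfun G b L p ∧
      Jfun G b L p ≤ ENNReal.ofReal (C * (L ^ adim N G b p.1 p.2 *
          Real.exp (L * (p.2 + msup N G b p.1 p.2))))) := by
    intro p
    by_cases hp : p ∈ Gcirc N G
    · obtain ⟨C, hC, hb⟩ := (exists_Jfun_bounds hA hp).2
      exact ⟨C, hC, fun _ => hb⟩
    · exact ⟨1, le_rfl, fun h => (hp h).elim⟩
  choose C hC hb using h
  have hne := Gcirc_nonempty hG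
  set K := ∑ p ∈ Gcirc N G, C p with hK
  have hCK : ∀ p ∈ Gcirc N G, C p ≤ K := fun p hp =>
    Finset.single_le_sum (f := C) (fun q _ => zero_le_one.trans (hC q)) hp
  have hK1 : 1 ≤ K := by
    obtain ⟨p, hp⟩ := hne
    exact (hC p).trans (hCK p hp)
  have hcG : (1 : ℝ) ≤ G.card := by exact_mod_cast Finset.card_pos.2 hG
  have hcG' : (1 : ℝ) ≤ (Gcirc N G).card := by exact_mod_cast Finset.card_pos.2 hne
  refine ⟨(Gcirc N G).card * (G.card * K), one_le_mul_of_one_le_of_one_le hcG'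
    (one_le_mul_of_one_le_of_one_le hcG hK1), fun L hL => ?_⟩
  have hL0 : 0 < L := by linarith
  set X : (Fin N → ℕ) × ℝ → ℝ := fun p =>
    L ^ adim N G b p.1 p.2 * Real.exp (L * (p.2 + msup N G b p.1 p.2)) with hX
  have hX0 : ∀ p, 0 ≤ X p := fun p => by positivity
  constructor
  · obtain ⟨p, hp, hpmax⟩ := (Gcirc N G).exists_max_image X hne
    have hsum : ∑ q ∈ Gcirc N G, X q ≤ (Gcirc N G).card * X p := by
      simpa using Finset.sum_le_card_nsmul _ X _ hpmax
    refine le_trans ?_ (card_inv_mul_Jfun_le hL0 (Finset.mem_filter.1 hp).1)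
    refine le_trans ?_ (mul_le_mul_right (hb p hp L hL).1 _)
    rw [← ENNReal.ofReal_mul (by positivity)]
    refine ENNReal.ofReal_le_ofReal ?_
    calc ((Gcirc N G).card * (G.card * K) : ℝ)⁻¹ * ∑ q ∈ Gcirc N G, X q
        ≤ ((Gcirc N G).card * (G.card * K) : ℝ)⁻¹ * ((Gcirc N G).card * X p) := by gcongr
      _ = (G.card : ℝ)⁻¹ * (K⁻¹ * X p) := by field_simp
      _ ≤ (G.card : ℝ)⁻¹ * ((C p)⁻¹ * X p) := by
        have := hX0 p
        have := zero_lt_one.trans_le (hC p)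
        gcongr
        exact hCK p hp
  · calc Ifun N G b (Real.exp (-L)) ≤ ∑ p ∈ Gcirc N G, Jfun G b L p := Ifun_le_sum_Jfun hG hL0
      _ ≤ ∑ p ∈ Gcirc N G, ENNReal.ofReal (K * X p) := by
        refine Finset.sum_le_sum fun p hp => (hb p hp L hL).2.trans ?_
        exact ENNReal.ofReal_le_ofReal (mul_le_mul_of_nonneg_right (hCK p hp) (hX0 p))
      _ = ENNReal.ofReal (K * ∑ p ∈ Gcirc N G, X p) := by
        rw [Finset.mul_sum, ENNReal.ofReal_sum_of_nonneg fun p _ =>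
          mul_nonneg (zero_le_one.trans hK1) (hX0 p)]
      _ ≤ _ := by
        refine ENNReal.ofReal_le_ofReal (mul_le_mul_of_nonneg_right ?_
          (Finset.sum_nonneg fun p _ => hX0 p))
        calc K = 1 * (1 * K) := by ring
          _ ≤ _ := by gcongr

theorem exists_rat_eq_add_msup {G : Finset ((Fin N → ℕ) × ℝ)} {b : Fin N → ℕ}
    (hA : Ifun N G b (Real.exp (-1)) < ⊤) (hint : ∀ p ∈ G, ∃ k : ℕ, p.2 = (k : ℝ))
    {p : (Fin N → ℕ) × ℝ} (hp : p ∈ Gcirc N G) :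
    ∃ q : ℚ, p.2 + msup N G b p.1 p.2 = q := by
  obtain ⟨x, hx, hmax, hm⟩ := (exists_Jfun_bounds hA hp).1
  obtain ⟨k, hk⟩ := hint p (Finset.mem_filter.1 hp).1
  rw [Pset_eq_polyhedron] at hx hmax
  rw [phiFun_eq_coordForm] at hmax hm
  obtain ⟨q, hq⟩ := exists_rat_eq_of_isMax (c := pBound G p.2) (fun i => by
    cases i with
    | inl j => exact ⟨0, by simp [pBound]⟩
    | inr p' =>
      obtain ⟨k', hk'⟩ := hint p'.1 p'.2
      exact ⟨k' - k, by simp [pBound, hk, hk']⟩) hx hmax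
  exact ⟨k + q, by rw [hm, hq, hk]; push_cast; rfl⟩

end Assembly

/-- Under assumption (A),
`I(r) ≈ Σ_{(a,s)∈𝔊°} r^{−s−m_{a,s}} (ln(1/r))^{d_{a,s}} ≈ r^{−α₀} (ln(1/r))^{d₀}` as
`r → 0⁺`, where `α₀ = max{s + m_{a,s} : (a,s) ∈ 𝔊°}` and
`d₀ = max{d_{a,s} : (a,s) ∈ 𝔊°, s + m_{a,s} = α₀}`; moreover, if every `s` appearing in `𝔊`
is a nonnegative integer, then `α₀` is rational. -/
theorem stmt13 (N : ℕ) (hN : 1 ≤ N) (G : Finset ((Fin N → ℕ) × ℝ)) (hGne : G.Nonempty)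
    (hGs : ∀ p ∈ G, 0 ≤ p.2) (b : Fin N → ℕ)
    (hA : ∀ r : ℝ, 0 < r → r < 1 → Ifun N G b r < ⊤) :
    ∃ (α₀ : ℝ) (d₀ : ℕ),
      (∃ p ∈ Gcirc N G, α₀ = p.2 + msup N G b p.1 p.2) ∧
      (∀ p ∈ Gcirc N G, p.2 + msup N G b p.1 p.2 ≤ α₀) ∧
      (∃ p ∈ Gcirc N G, p.2 + msup N G b p.1 p.2 = α₀ ∧ d₀ = adim N G b p.1 p.2) ∧
      (∀ p ∈ Gcirc N G, p.2 + msup N G b p.1 p.2 = α₀ → adim N G b p.1 p.2 ≤ d₀) ∧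
      (∃ C : ℝ, 1 ≤ C ∧ ∃ r₀ : ℝ, 0 < r₀ ∧ r₀ < 1 ∧ ∀ r : ℝ, 0 < r → r < r₀ →
        (ENNReal.ofReal (C⁻¹ * ∑ p ∈ Gcirc N G,
            (Real.log (1/r)) ^ (adim N G b p.1 p.2) / r ^ (p.2 + msup N G b p.1 p.2)) ≤
          Ifun N G b r ∧
         Ifun N G b r ≤ ENNReal.ofReal (C * ∑ p ∈ Gcirc N G,
            (Real.log (1/r)) ^ (adim N G b p.1 p.2) / r ^ (p.2 + msup N G b p.1 p.2))) ∧
        (C⁻¹ * ((Real.log (1/r)) ^ d₀ / r ^ α₀) ≤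
            (∑ p ∈ Gcirc N G,
              (Real.log (1/r)) ^ (adim N G b p.1 p.2) / r ^ (p.2 + msup N G b p.1 p.2)) ∧
         (∑ p ∈ Gcirc N G,
              (Real.log (1/r)) ^ (adim N G b p.1 p.2) / r ^ (p.2 + msup N G b p.1 p.2)) ≤
            C * ((Real.log (1/r)) ^ d₀ / r ^ α₀))) ∧
      ((∀ p ∈ G, ∃ k : ℕ, p.2 = (k : ℝ)) → ∃ q : ℚ, α₀ = (q : ℝ)) := by
  have hA1 : Ifun N G b (Real.exp (-1)) < ⊤ :=
    hA _ (Real.exp_pos _) (by simp)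
  obtain ⟨p₀, hp₀, hmax₀⟩ := (Gcirc N G).exists_max_image
    (fun p => p.2 + msup N G b p.1 p.2) (Gcirc_nonempty hGne)
  set α₀ := p₀.2 + msup N G b p₀.1 p₀.2 with hα₀
  obtain ⟨p₁, hp₁, hmax₁⟩ := ((Gcirc N G).filter fun p => p.2 + msup N G b p.1 p.2 = α₀).exists_max_image
    (fun p => adim N G b p.1 p.2) ⟨p₀, Finset.mem_filter.2 ⟨hp₀, rfl⟩⟩
  obtain ⟨hp₁G, hp₁α⟩ := Finset.mem_filter.1 hp₁
  have hd₀ : ∀ p ∈ Gcirc N G, p.2 + msup N G b p.1 p.2 = α₀ →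
      adim N G b p.1 p.2 ≤ adim N G b p₁.1 p₁.2 :=
    fun p hp hpα => hmax₁ p (Finset.mem_filter.2 ⟨hp, hpα⟩)
  refine ⟨α₀, adim N G b p₁.1 p₁.2, ⟨p₀, hp₀, rfl⟩, hmax₀, ⟨p₁, hp₁G, hp₁α, rfl⟩, hd₀, ?_,
    fun hint => exists_rat_eq_add_msup hA1 hint hp₀⟩
  obtain ⟨C, hC, hI⟩ := exists_Ifun_bounds hGne hA1
  obtain ⟨D, hD, hS⟩ := exists_sum_le_leading (Gcirc N G) (fun p => p.2 + msup N G b p.1 p.2)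
    (fun p => adim N G b p.1 p.2) hmax₀ hd₀
  refine ⟨max C D, le_max_of_le_left hC, Real.exp (-1), Real.exp_pos _,
    by simp, fun r hr hr₀ => ?_⟩
  set L := Real.log (1 / r) with hL
  have hLr : L = -Real.log r := by rw [hL, one_div, Real.log_inv]
  have hrL : r = Real.exp (-L) := by rw [hLr, neg_neg, Real.exp_log hr]
  have hL1 : 1 ≤ L := by
    have := Real.log_lt_log hr hr₀
    rw [Real.log_exp] at this
    linarith
  have hterm : ∀ (α : ℝ) (d : ℕ), L ^ d / r ^ α = L ^ d * Real.exp (L * α) := by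
    intro α d
    rw [hrL, ← Real.exp_mul, div_eq_mul_inv, ← Real.exp_neg]
    ring_nf
  simp only [hterm]
  have hpos : ∀ p : (Fin N → ℕ) × ℝ, 0 ≤ L ^ adim N G b p.1 p.2 *
      Real.exp (L * (p.2 + msup N G b p.1 p.2)) := fun p => by positivity
  have hsum := Finset.sum_nonneg fun p (_ : p ∈ Gcirc N G) => hpos p
  obtain ⟨h1, h2⟩ := hI L hL1
  rw [← hrL] at h1 h2
  refine ⟨⟨le_trans (ENNReal.ofReal_le_ofReal ?_) h1, h2.trans (ENNReal.ofReal_le_ofReal ?_)⟩,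
    ?_, (hS L hL1).trans ?_⟩
  · exact mul_le_mul_of_nonneg_right
      (inv_anti₀ (zero_lt_one.trans_le hC) (le_max_left _ _)) hsum
  · exact mul_le_mul_of_nonneg_right (le_max_left _ _) hsum
  · refine le_trans (mul_le_of_le_one_left (by positivity)
      (inv_le_one_of_one_le₀ (le_max_of_le_left hC))) ?_
    rw [← hp₁α]
    exact Finset.single_le_sum (f := fun p : (Fin N → ℕ) × ℝ => L ^ adim N G b p.1 p.2 *
      Real.exp (L * (p.2 + msup N G b p.1 p.2))) (fun p _ => hpos p) hp₁G
  · gcongr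
    exact le_max_right _ _
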